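/- Every zero of η is a zero of ζ, counted with multiplicity (i.e., at every zero s₀ of η, the multiplicity of s₀ as a zero of ζ is at least that of η). Moreover, the only zeros of η with Re(s) < 0 are the poles of Γ(s/2) (the trivial zeros of ζ), and every zero of η with Re(s) ≥ 0 lies on the line Re(s) = 1/2. -/

import Mathlib

open Complex Filter Topology

/-- `h(s) = (1/2) ∏_ν (1 - (s - s²)/|s_ν|²)`. -/
noncomputable def hfun (sν : ℕ → ℂ) (s : ℂ) : ℂ :=
  (1 / 2 : ℂ) * ∏' ν : ℕ, (1 - (s - s ^ 2) / ((‖sν ν‖ : ℂ) ^ 2))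

/-- `f` has a zero of exact order `m` at `z`. -/
def ZeroOfOrder (f : ℂ → ℂ) (z : ℂ) (m : ℕ) : Prop :=
  ∃ g : ℂ → ℂ, AnalyticAt ℂ g z ∧ g z ≠ 0 ∧
    ∀ᶠ w in 𝓝[≠] z, f w = (w - z) ^ m * g w

/-- `sν` enumerates, counted with multiplicity, the zeros of `f` with `Re = 1/2`, `Im > 0`. -/
def CriticalZeroEnumFor (f : ℂ → ℂ) (sν : ℕ → ℂ) : Prop :=
  (∀ ν, (sν ν).re = 1 / 2 ∧ 0 < (sν ν).im ∧ f (sν ν) = 0) ∧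
  ∀ z : ℂ, z.re = 1 / 2 → 0 < z.im → f z = 0 →
    ZeroOfOrder f z (Nat.card {ν : ℕ // sν ν = z})

/-- `η`, defined by `h(s) = (s/2)(s-1)π^{-s/2}Γ(s/2)η(s)`. -/
noncomputable def etaFun (sν : ℕ → ℂ) (s : ℂ) : ℂ :=
  hfun sν s / (s / 2 * (s - 1) * (Real.pi : ℂ) ^ (-s / 2) * Complex.Gamma (s / 2))

lemma ZeroOfOrder.meromorphicOrderAt_eq {f : ℂ → ℂ} {z : ℂ} {m : ℕ} (h : ZeroOfOrder f z m) :
    meromorphicOrderAt f z = ((m : ℤ) : WithTop ℤ) := by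
  obtain ⟨g, hg, hgz, hfg⟩ := h
  have hmero : MeromorphicAt f z := by
    have h1 : MeromorphicAt (fun w ↦ (w - z) ^ m * g w) z :=
      AnalyticAt.meromorphicAt (by fun_prop)
    exact h1.congr (hfg.mono fun w hw ↦ hw.symm)
  refine (meromorphicOrderAt_eq_int_iff hmero).2 ⟨g, hg, hgz, ?_⟩
  simpa using hfg

lemma ZeroOfOrder.unique {f : ℂ → ℂ} {z : ℂ} {m n : ℕ} (hm : ZeroOfOrder f z m)
    (hn : ZeroOfOrder f z n) : m = n := by
  have h := hm.meromorphicOrderAt_eq.symm.trans hn.meromorphicOrderAt_eq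
  exact_mod_cast h

lemma ZeroOfOrder.mul_analytic {f f' F : ℂ → ℂ} {z : ℂ} {m : ℕ} (h : ZeroOfOrder f z m)
    (hF : AnalyticAt ℂ F z) (hFz : F z ≠ 0) (hf' : ∀ᶠ w in 𝓝[≠] z, f' w = f w * F w) :
    ZeroOfOrder f' z m := by
  obtain ⟨g, hg, hgz, hfg⟩ := h
  refine ⟨fun w ↦ g w * F w, hg.mul hF, mul_ne_zero hgz hFz, ?_⟩
  filter_upwards [hfg, hf'] with w h1 h2
  rw [h2, h1, mul_assoc]

lemma ZeroOfOrder.eventually_ne {f : ℂ → ℂ} {z : ℂ} {m : ℕ} (h : ZeroOfOrder f z m) :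
    ∀ᶠ w in 𝓝[≠] z, f w ≠ 0 := by
  obtain ⟨g, hg, hgz, hfg⟩ := h
  filter_upwards [hfg, (hg.continuousAt.eventually_ne hgz).filter_mono nhdsWithin_le_nhds,
    self_mem_nhdsWithin] with w h1 h2 h3
  rw [h1]
  exact mul_ne_zero (pow_ne_zero _ (sub_ne_zero.2 h3)) h2

lemma ZeroOfOrder.tendsto_zero {f : ℂ → ℂ} {z : ℂ} {m : ℕ} (h : ZeroOfOrder f z m)
    (hm : 1 ≤ m) : Tendsto f (𝓝[≠] z) (𝓝 0) := by
  obtain ⟨g, hg, -, hfg⟩ := h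
  have h1 : ContinuousAt (fun w ↦ (w - z) ^ m * g w) z := by
    have := hg.continuousAt
    fun_prop
  have h2 : Tendsto (fun w ↦ (w - z) ^ m * g w) (𝓝[≠] z) (𝓝 0) := by
    have h3 := h1.tendsto.mono_left (nhdsWithin_le_nhds (s := {z}ᶜ))
    simpa [show m ≠ 0 by lia] using h3
  exact h2.congr' (hfg.mono fun w hw ↦ hw.symm)

lemma ZeroOfOrder.ne_zero_of_order_zero {f : ℂ → ℂ} {z : ℂ} (h : ZeroOfOrder f z 0)
    (hf : ContinuousAt f z) : f z ≠ 0 := by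
  obtain ⟨g, hg, hgz, hfg⟩ := h
  have h1 : Tendsto f (𝓝[≠] z) (𝓝 (g z)) :=
    (hg.continuousAt.tendsto.mono_left nhdsWithin_le_nhds).congr'
      (hfg.mono fun w hw ↦ by simpa using hw.symm)
  rw [tendsto_nhds_unique (hf.tendsto.mono_left nhdsWithin_le_nhds) h1]
  exact hgz

lemma ZeroOfOrder.riemannZeta_of_one_sub {z : ℂ} (hz0 : 0 < z.re) (hz1 : z.re < 1) {k : ℕ}
    (h : ZeroOfOrder riemannZeta (1 - z) k) : ZeroOfOrder riemannZeta z k := by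
  obtain ⟨g, hg, hgz, hfg⟩ := h
  have hG (w : ℂ) : AnalyticAt ℂ (fun w ↦ (Gammaℝ w)⁻¹) w :=
    differentiable_Gammaℝ_inv.analyticAt w
  have hsub : AnalyticAt ℂ (fun w : ℂ ↦ 1 - w) z := by fun_prop
  have hz' : 0 < (1 - z).re := by simpa using hz1
  have hA : AnalyticAt ℂ (fun w ↦ (-1) ^ k * g (1 - w) * ((Gammaℝ (1 - w))⁻¹)⁻¹ *
      (Gammaℝ w)⁻¹) z := by
    have h1 : AnalyticAt ℂ (fun w ↦ g (1 - w)) z := hg.fun_comp hsub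
    have h2 : AnalyticAt ℂ (fun w ↦ (Gammaℝ (1 - w))⁻¹) z := (hG _).fun_comp hsub
    exact ((analyticAt_const.mul h1).mul
      (h2.inv (inv_ne_zero (Gammaℝ_ne_zero_of_re_pos hz')))).mul (hG z)
  refine ⟨_, hA, ?_, ?_⟩
  · have h1 := Gammaℝ_ne_zero_of_re_pos hz'
    have h2 := Gammaℝ_ne_zero_of_re_pos hz0
    simp [h1, h2, hgz]
  · have ht : Tendsto (fun w : ℂ ↦ 1 - w) (𝓝[≠] z) (𝓝[≠] (1 - z)) := by
      refine tendsto_nhdsWithin_of_tendsto_nhds_of_eventually_within _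
        (hsub.continuousAt.tendsto.mono_left nhdsWithin_le_nhds) ?_
      filter_upwards [self_mem_nhdsWithin] with w hw h
      exact hw (by simpa using h)
    have hre1 : ∀ᶠ w : ℂ in 𝓝[≠] z, 0 < w.re :=
      (continuous_re.continuousAt.eventually_const_lt hz0).filter_mono nhdsWithin_le_nhds
    have hre2 : ∀ᶠ w : ℂ in 𝓝[≠] z, w.re < 1 :=
      (continuous_re.continuousAt.eventually_lt_const hz1).filter_mono nhdsWithin_le_nhds
    filter_upwards [ht.eventually hfg, hre1, hre2] with w h1 h2 h3
    have hw' : 0 < (1 - w).re := by simpa using h3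
    have hw0 : w ≠ 0 := fun h ↦ by simp [h] at h2
    have hw1 : 1 - w ≠ 0 := fun h ↦ by simp [h] at hw'
    have hG1 := Gammaℝ_ne_zero_of_re_pos hw'
    have hG2 := Gammaℝ_ne_zero_of_re_pos h2
    rw [riemannZeta_def_of_ne_zero hw1, completedRiemannZeta_one_sub,
      div_eq_iff hG1] at h1
    rw [riemannZeta_def_of_ne_zero hw0, h1, inv_inv,
      show (1 - w - (1 - z)) = (-1) * (w - z) by ring, mul_pow]
    ring

lemma differentiable_tprod_one_add_mul {ι : Type*} {c : ι → ℂ} (hc : Summable fun i ↦ ‖c i‖) :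
    Differentiable ℂ fun u ↦ ∏' i, (1 + u * c i) := by
  intro u
  have h := (Summable.hasProdLocallyUniformlyOn_one_add (f := fun i u ↦ u * c i)
    (K := Metric.ball (0 : ℂ) (‖u‖ + 1)) Metric.isOpen_ball (hc.mul_left (‖u‖ + 1))
    (.of_forall fun i x hx ↦ ?_) (fun i ↦ by fun_prop))
  · refine (h.differentiableOn (.of_forall fun _ ↦ ?_) Metric.isOpen_ball).differentiableAt
      (Metric.isOpen_ball.mem_nhds (by simp))
    simpa [Finset.prod_fn] using DifferentiableOn.finsetProd (fun _ _ ↦ by fun_prop)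
  · rw [norm_mul]
    gcongr
    simpa using (mem_ball_zero_iff.1 hx).le

lemma finite_norm_le_of_enum {sν : ℕ → ℂ} (henum : CriticalZeroEnumFor riemannZeta sν) (R : ℝ) :
    {ν | ‖sν ν‖ ≤ R}.Finite := by
  have hfib (z : ℂ) : {ν | sν ν = z}.Finite := by
    by_contra hinf
    have hinf' : Infinite {ν // sν ν = z} := Set.infinite_coe_iff.2 hinf
    obtain ⟨ν, hν⟩ := Set.Infinite.nonempty hinf
    obtain ⟨h1, h2, h3⟩ := henum.1 ν
    have hν' : sν ν = z := hν
    rw [hν'] at h1 h2 h3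
    have h4 := henum.2 z h1 h2 h3
    rw [Nat.card_eq_zero_of_infinite] at h4
    refine h4.ne_zero_of_order_zero (differentiableAt_riemannZeta ?_).continuousAt h3
    rintro rfl
    simp at h2
  have hK := (isCompact_closedBall (0 : ℂ) R).inter_riemannZetaZeros_finite
  refine (hK.preimage' (f := sν) fun z _ ↦ hfib z).subset fun ν hν ↦ ⟨?_, (henum.1 ν).2.2⟩
  simpa using hν

lemma hfun_factor {s z : ℂ} (hs : s.re = 1 / 2) (hs' : 0 < s.im) :
    1 - (z - z ^ 2) / ((‖s‖ : ℂ) ^ 2) = (z - s) * (z - (1 - s)) / ((‖s‖ : ℂ) ^ 2) := by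
  have h0 : s ≠ 0 := fun h ↦ by simp [h] at hs'
  have h1 : (‖s‖ : ℂ) ^ 2 = s * (1 - s) := by
    rw [← Complex.mul_conj']
    congr 1
    apply Complex.ext
    · simp; linarith
    · simp
  have h2 : (‖s‖ : ℂ) ^ 2 ≠ 0 := by simpa using h0
  rw [eq_div_iff h2, sub_mul, div_mul_cancel₀ _ h2, h1]
  ring

lemma hfun_dichotomy_of_summable {sν : ℕ → ℂ} (henum : CriticalZeroEnumFor riemannZeta sν)
    (hsum : Summable fun ν ↦ (‖sν ν‖ ^ 2)⁻¹) (z : ℂ) :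
    AnalyticAt ℂ (hfun sν) z ∧ (hfun sν z ≠ 0 ∨
      z.re = 1 / 2 ∧ ∃ k, ZeroOfOrder (hfun sν) z k ∧ ZeroOfOrder riemannZeta z k) := by
  classical
  set c : ℕ → ℂ := fun ν ↦ ((‖sν ν‖ : ℂ) ^ 2)⁻¹ with hc
  have hcs : Summable fun ν ↦ ‖c ν‖ := by simpa [hc] using hsum
  have hfac (w : ℂ) (ν : ℕ) : 1 - (w - w ^ 2) / ((‖sν ν‖ : ℂ) ^ 2) = 1 + (w ^ 2 - w) * c ν := by
    simp only [hc]; ring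
  have hh (w : ℂ) : hfun sν w = 1 / 2 * ∏' ν, (1 + (w ^ 2 - w) * c ν) := by
    simp only [hfun, hfac]
  have hfac' (w : ℂ) (ν : ℕ) : 1 + (w ^ 2 - w) * c ν =
      (w - sν ν) * (w - (1 - sν ν)) / ((‖sν ν‖ : ℂ) ^ 2) := by
    rw [← hfac, hfun_factor (henum.1 ν).1 (henum.1 ν).2.1]
  have hpos (ν : ℕ) : ((‖sν ν‖ : ℂ) ^ 2) ≠ 0 := by
    have : sν ν ≠ 0 := fun h ↦ by simpa [h] using (henum.1 ν).2.1
    simpa using this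
  have han : AnalyticAt ℂ (hfun sν) z := by
    have h1 := (differentiable_tprod_one_add_mul hcs).comp
      (show Differentiable ℂ fun w : ℂ ↦ w ^ 2 - w by fun_prop)
    have h2 : Differentiable ℂ (hfun sν) := by
      rw [funext hh]
      exact h1.const_mul _
    exact h2.analyticAt z
  refine ⟨han, ?_⟩
  have hzero (ν : ℕ) : 1 + (z ^ 2 - z) * c ν = 0 ↔ sν ν = z ∨ sν ν = 1 - z := by
    rw [hfac', div_eq_zero_iff, or_iff_left (hpos ν), mul_eq_zero, sub_eq_zero, sub_eq_zero]
    constructor <;> rintro (h | h)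
    · exact .inl h.symm
    · exact .inr (by rw [h]; ring)
    · exact .inl h.symm
    · exact .inr (by rw [h]; ring)
  by_cases hT : ∃ ν, 1 + (z ^ 2 - z) * c ν = 0
  swap
  · left
    push Not at hT
    rw [hh]
    exact mul_ne_zero (by norm_num)
      (tprod_one_add_ne_zero_of_summable hT (by simpa using hcs.mul_left ‖z ^ 2 - z‖))
  right
  have hTfin : {ν | 1 + (z ^ 2 - z) * c ν = 0}.Finite := by
    refine (finite_norm_le_of_enum henum (max ‖z‖ ‖1 - z‖)).subset fun ν hν ↦ ?_
    rcases (hzero ν).1 hν with h | h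
    · simp [h]
    · simp [h]
  set T := hTfin.toFinset with hTdef
  have hzre : z.re = 1 / 2 := by
    obtain ⟨ν, hν⟩ := hT
    have h1 := (henum.1 ν).1
    rcases (hzero ν).1 hν with h | h
    · rw [← h, h1]
    · rw [h] at h1
      simp at h1
      linarith
  have hzim : z.im ≠ 0 := by
    obtain ⟨ν, hν⟩ := hT
    have h1 := (henum.1 ν).2.1
    rcases (hzero ν).1 hν with h | h
    · rw [← h]; exact h1.ne'
    · rw [h] at h1
      simp at h1
      exact h1.ne
  refine ⟨hzre, T.card, ?_, ?_⟩
  · set Q : ℂ → ℂ := fun u ↦ ∏' ν : ↥((T : Set ℕ)ᶜ), (1 + u * c ν) with hQ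
    have hcs' : Summable fun ν : ↥((T : Set ℕ)ᶜ) ↦ ‖c ν‖ := hcs.subtype _
    have hQd : Differentiable ℂ Q := differentiable_tprod_one_add_mul hcs'
    have hQz : Q (z ^ 2 - z) ≠ 0 := by
      refine tprod_one_add_ne_zero_of_summable (fun ν h ↦ ν.2 ?_)
        (by simpa using hcs'.mul_left ‖z ^ 2 - z‖)
      simpa [hTdef] using h
    have hd : z - (1 - z) ≠ 0 := fun h ↦ by
      have := congrArg Complex.im h
      simp at this
      exact hzim (by linarith)
    have hQd' : Differentiable ℂ fun w : ℂ ↦ Q (w ^ 2 - w) :=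
      hQd.comp (g := Q) (show Differentiable ℂ fun w : ℂ ↦ w ^ 2 - w by fun_prop)
    refine ⟨fun w ↦ 1 / 2 * ((w - (1 - z)) ^ T.card * ∏ ν ∈ T, c ν) * Q (w ^ 2 - w), ?_, ?_,
      .of_forall fun w ↦ ?_⟩
    · refine Differentiable.analyticAt (Differentiable.mul ?_ hQd') z
      fun_prop
    · refine mul_ne_zero (mul_ne_zero (by norm_num) (mul_ne_zero (pow_ne_zero _ hd) ?_)) hQz
      exact Finset.prod_ne_zero_iff.2 fun ν _ ↦ inv_ne_zero (hpos ν)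
    · have hmul' : Multipliable fun ν : ↥((T : Set ℕ)ᶜ) ↦ 1 + (w ^ 2 - w) * c ν :=
        multipliable_one_add_of_summable (by simpa using hcs'.mul_left ‖w ^ 2 - w‖)
      have hsplit : ∏' ν, (1 + (w ^ 2 - w) * c ν) =
          (∏ ν ∈ T, (1 + (w ^ 2 - w) * c ν)) * Q (w ^ 2 - w) :=
        ((T.hasProd fun ν ↦ 1 + (w ^ 2 - w) * c ν).mul_compl hmul'.hasProd).tprod_eq
      rw [hh, hsplit]
      have hprod : ∏ ν ∈ T, (1 + (w ^ 2 - w) * c ν) =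
          ∏ ν ∈ T, ((w - z) * (w - (1 - z)) * c ν) := by
        refine Finset.prod_congr rfl fun ν hν ↦ ?_
        have hν' : 1 + (z ^ 2 - z) * c ν = 0 := by simpa [hTdef] using hν
        linear_combination hν'
      rw [hprod, Finset.prod_mul_distrib, Finset.prod_const, mul_pow]
      ring
  · have hcard (y : ℂ) (hy : ∀ ν, ν ∈ T ↔ sν ν = y) :
        Nat.card {ν : ℕ // sν ν = y} = T.card :=
      Nat.subtype_card T hy
    have hmem (ν : ℕ) : ν ∈ T ↔ sν ν = z ∨ sν ν = 1 - z := by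
      rw [← hzero]
      simp [hTdef]
    obtain ⟨ν₀, hν₀⟩ := hT
    have hν₀' := (hzero ν₀).1 hν₀
    have him (ν : ℕ) := (henum.1 ν).2.1
    rcases hzim.lt_or_gt with hneg | hpos
    · have hy (ν : ℕ) : ν ∈ T ↔ sν ν = 1 - z := by
        rw [hmem, or_iff_right]
        intro h
        have := him ν
        rw [h] at this
        exact this.not_gt hneg
      have h1 : sν ν₀ = 1 - z := (hy ν₀).1 ((hmem ν₀).2 hν₀')
      refine ZeroOfOrder.riemannZeta_of_one_sub (by rw [hzre]; norm_num)
        (by rw [hzre]; norm_num) ?_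
      rw [← hcard _ hy, ← h1]
      exact henum.2 _ (henum.1 ν₀).1 (henum.1 ν₀).2.1 (henum.1 ν₀).2.2
    · have hy (ν : ℕ) : ν ∈ T ↔ sν ν = z := by
        rw [hmem, or_iff_left]
        intro h
        have := him ν
        rw [h] at this
        simp at this
        exact this.not_gt hpos
      have h1 : sν ν₀ = z := (hy ν₀).1 ((hmem ν₀).2 hν₀')
      rw [← hcard _ hy, ← h1]
      exact henum.2 _ (henum.1 ν₀).1 (henum.1 ν₀).2.1 (henum.1 ν₀).2.2

lemma tendsto_sum_atTop_of_not_summable {ι : Type*} {a : ι → ℝ} (ha : ∀ i, 0 ≤ a i)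
    (hns : ¬ Summable a) : Tendsto (fun s : Finset ι ↦ ∑ i ∈ s, a i) atTop atTop := by
  refine tendsto_atTop_atTop.2 fun b ↦ ?_
  by_contra! h
  refine hns (summable_of_sum_le (c := b) ha fun s ↦ ?_)
  obtain ⟨t, hst, ht⟩ := h s
  exact (Finset.sum_le_sum_of_subset_of_nonneg hst fun i _ _ ↦ ha i).trans ht.le

lemma normSq_one_sub_mul_ofReal (u : ℂ) (a : ℝ) :
    ‖1 - u * a‖ ^ 2 = 1 - 2 * u.re * a + ‖u‖ ^ 2 * a ^ 2 := by
  rw [Complex.sq_norm, Complex.sq_norm, Complex.normSq_apply, Complex.normSq_apply]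
  simp
  ring

lemma tprod_one_sub_eq_zero {ι : Type*} {a : ι → ℝ} (ha : ∀ i, 0 ≤ a i) (hns : ¬ Summable a)
    (ha0 : Tendsto a cofinite (𝓝 0)) {u : ℂ} (hu : 0 < u.re) :
    ∏' i, (1 - u * a i) = 0 := by
  classical
  have hu0 : u ≠ 0 := fun h ↦ by simp [h] at hu
  have hun : 0 < ‖u‖ ^ 2 := by positivity
  have hsmall : {i | ¬ a i < u.re / ‖u‖ ^ 2}.Finite :=
    ha0.eventually_lt_const (u := u.re / ‖u‖ ^ 2) (by positivity)
  set s₀ := hsmall.toFinset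
  have hbound (i : ι) (hi : i ∉ s₀) : ‖1 - u * a i‖ ^ 2 ≤ Real.exp (-(u.re * a i)) := by
    have h1 : a i < u.re / ‖u‖ ^ 2 := by simpa [s₀] using hi
    rw [lt_div_iff₀ hun] at h1
    rw [normSq_one_sub_mul_ofReal]
    have h2 := Real.add_one_le_exp (-(u.re * a i))
    nlinarith [mul_le_mul_of_nonneg_left h1.le (ha i)]
  have hsum := tendsto_sum_atTop_of_not_summable ha hns
  have hlim : Tendsto (fun s : Finset ι ↦ (∏ i ∈ s₀, ‖1 - u * a i‖ ^ 2) *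
      Real.exp (-(u.re * (∑ i ∈ s, a i - ∑ i ∈ s₀, a i)))) atTop (𝓝 0) := by
    have h1 : Tendsto (fun s : Finset ι ↦ u.re * (∑ i ∈ s, a i - ∑ i ∈ s₀, a i)) atTop atTop :=
      (tendsto_atTop_add_const_right _ (-∑ i ∈ s₀, a i) hsum).const_mul_atTop hu
    simpa using (Real.tendsto_exp_neg_atTop_nhds_zero.comp h1).const_mul
      (∏ i ∈ s₀, ‖1 - u * a i‖ ^ 2)
  have hsq : Tendsto (fun s : Finset ι ↦ ‖∏ i ∈ s, (1 - u * a i)‖ ^ 2) atTop (𝓝 0) := by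
    refine squeeze_zero' (.of_forall fun s ↦ by positivity) ?_ hlim
    filter_upwards [eventually_ge_atTop s₀] with s hs
    rw [norm_prod, ← Finset.prod_pow, ← Finset.sum_sdiff hs, ← Finset.prod_sdiff hs,
      add_sub_cancel_right, mul_comm, Finset.mul_sum, ← Finset.sum_neg_distrib, Real.exp_sum]
    gcongr with i hi
    exact hbound i (Finset.mem_sdiff.1 hi).2
  have hprod : HasProd (fun i ↦ 1 - u * a i) 0 := by
    rw [HasProd, SummationFilter.unconditional_filter]
    refine tendsto_zero_iff_norm_tendsto_zero.2 ?_
    simpa only [Real.sqrt_sq (norm_nonneg _), Real.sqrt_zero] using hsq.sqrt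
  exact hprod.tprod_eq

lemma one_add_sum_le_prod_one_add {ι : Type*} (s : Finset ι) {f : ι → ℝ} (hf : ∀ i, 0 ≤ f i) :
    1 + ∑ i ∈ s, f i ≤ ∏ i ∈ s, (1 + f i) := by
  classical
  induction s using Finset.induction_on with
  | empty => simp
  | insert i s hi ih =>
    rw [Finset.sum_insert hi, Finset.prod_insert hi]
    nlinarith [hf i, Finset.sum_nonneg fun j (_ : j ∈ s) ↦ hf j]

lemma tprod_one_sub_eq_one {ι : Type*} {a : ι → ℝ} (ha : ∀ i, 0 ≤ a i) (hns : ¬ Summable a)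
    {u : ℂ} (hu : u.re < 0) : ∏' i, (1 - u * a i) = 1 := by
  refine tprod_eq_one_of_not_multipliable fun ⟨p, hp⟩ ↦ ?_
  have h1 : Tendsto (fun s : Finset ι ↦ -2 * u.re * ∑ i ∈ s, a i) atTop atTop :=
    (tendsto_sum_atTop_of_not_summable ha hns).const_mul_atTop (by linarith)
  have h2 : Tendsto (fun s : Finset ι ↦ ‖∏ i ∈ s, (1 - u * a i)‖ ^ 2) atTop (𝓝 (‖p‖ ^ 2)) :=
    (show Tendsto (fun s : Finset ι ↦ ∏ i ∈ s, (1 - u * a i)) atTop (𝓝 p) from hp).norm.pow 2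
  refine not_tendsto_nhds_of_tendsto_atTop (tendsto_atTop_mono (fun s ↦ ?_) h1) _ h2
  rw [norm_prod, ← Finset.prod_pow, Finset.mul_sum]
  have h3 : ∏ i ∈ s, (1 + -2 * u.re * a i) ≤ ∏ i ∈ s, ‖1 - u * a i‖ ^ 2 := by
    refine Finset.prod_le_prod (fun i _ ↦ ?_) fun i _ ↦ ?_
    · nlinarith [ha i]
    · rw [normSq_one_sub_mul_ofReal]
      nlinarith [mul_nonneg (sq_nonneg ‖u‖) (sq_nonneg (a i))]
  refine le_trans ?_ h3
  have h4 := one_add_sum_le_prod_one_add s (f := fun i ↦ -2 * u.re * a i)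
    fun i ↦ by nlinarith [ha i]
  linarith

lemma frequently_re_sub_sq_pos {z : ℂ} (hz : 0 ≤ (z - z ^ 2).re) :
    ∃ᶠ w in 𝓝[≠] z, 0 < (w - w ^ 2).re := by
  obtain ⟨e, he, hze⟩ : ∃ e : ℝ, e ≠ 0 ∧ 0 ≤ z.im * e := by
    rcases le_total 0 z.im with h | h
    · exact ⟨1, one_ne_zero, by linarith⟩
    · exact ⟨-1, by norm_num, by linarith⟩
  have ht : Tendsto (fun t : ℝ ↦ z + (t * e : ℝ) * I) (𝓝[>] 0) (𝓝[≠] z) := by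
    refine tendsto_nhdsWithin_of_tendsto_nhds_of_eventually_within _ ?_ ?_
    · have : Continuous fun t : ℝ ↦ z + (t * e : ℝ) * I := by fun_prop
      have h := this.tendsto 0
      simp only [zero_mul, ofReal_zero, add_zero] at h
      exact h.mono_left nhdsWithin_le_nhds
    · filter_upwards [self_mem_nhdsWithin] with t ht h
      have ht' : t ≠ 0 := ne_of_gt ht
      simp [ht', he] at h
  refine ht.frequently (Eventually.frequently ?_)
  filter_upwards [self_mem_nhdsWithin] with t ht
  have ht' : 0 < t := ht
  have h1 : 0 < (t * e) ^ 2 := by positivity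
  simp only [pow_two, sub_re, add_re, mul_re, ofReal_re, I_re, ofReal_im, I_im, add_im,
    mul_im] at hz ⊢
  nlinarith [mul_nonneg ht'.le hze]

lemma hfun_analyticAt_ne_zero_of_not_summable {sν : ℕ → ℂ} (henum : CriticalZeroEnumFor riemannZeta sν)
    (hns : ¬ Summable fun ν ↦ (‖sν ν‖ ^ 2)⁻¹) {z : ℂ} {m : ℕ}
    (hz : ZeroOfOrder (etaFun sν) z m) : AnalyticAt ℂ (hfun sν) z ∧ hfun sν z ≠ 0 := by
  have ha (ν : ℕ) : 0 ≤ (‖sν ν‖ ^ 2)⁻¹ := by positivity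
  have hh (w : ℂ) : hfun sν w =
      1 / 2 * ∏' ν, (1 - (w - w ^ 2) * (((‖sν ν‖ ^ 2)⁻¹ : ℝ) : ℂ)) := by
    simp [hfun, div_eq_mul_inv]
  have ha0 : Tendsto (fun ν ↦ (‖sν ν‖ ^ 2)⁻¹) cofinite (𝓝 0) := by
    refine tendsto_inv_atTop_zero.comp ((tendsto_pow_atTop two_ne_zero).comp ?_)
    refine tendsto_atTop.2 fun b ↦ ?_
    refine (finite_norm_le_of_enum henum b).subset fun ν hν ↦ ?_
    exact (not_le.1 (show ¬ b ≤ ‖sν ν‖ from hν)).le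
  have hneg : (z - z ^ 2).re < 0 := by
    by_contra! h
    obtain ⟨w, hw1, hw2⟩ := ((frequently_re_sub_sq_pos h).and_eventually hz.eventually_ne).exists
    refine hw2 ?_
    rw [etaFun, hh, tprod_one_sub_eq_zero ha hns ha0 hw1]
    simp
  have hev : hfun sν =ᶠ[𝓝 z] fun _ ↦ 1 / 2 := by
    have hc : Continuous fun w : ℂ ↦ (w - w ^ 2).re := by fun_prop
    filter_upwards [hc.continuousAt.eventually_lt_const hneg] with w hw
    rw [hh, tprod_one_sub_eq_one ha hns hw, mul_one]
  refine ⟨analyticAt_const.congr hev.symm, ?_⟩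
  rw [hev.eq_of_nhds]
  norm_num

lemma etaFun_eq (sν : ℕ → ℂ) {w : ℂ} (hw : w ≠ 0) :
    etaFun sν w = hfun sν w / ((w - 1) * (Real.pi : ℂ) ^ (-w / 2) * Complex.Gamma (w / 2 + 1)) := by
  rw [etaFun, Complex.Gamma_add_one _ (div_ne_zero hw two_ne_zero)]
  congr 1
  ring

lemma eq_neg_two_mul_of_hfun_ne_zero {sν : ℕ → ℂ} {z : ℂ} {m : ℕ} (hm : 1 ≤ m)
    (hz : ZeroOfOrder (etaFun sν) z m) (hc : ContinuousAt (hfun sν) z) (hne : hfun sν z ≠ 0) :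
    ∃ n : ℕ, z = -2 * (n + 1) := by
  by_contra! hpole
  refine hne ?_
  have hpole' (n : ℕ) : z / 2 + 1 ≠ -n := fun h ↦ hpole n (by linear_combination 2 * h)
  have hpi : (Real.pi : ℂ) ≠ 0 := by exact_mod_cast Real.pi_ne_zero
  have hG : ContinuousAt (fun w : ℂ ↦ Complex.Gamma (w / 2 + 1)) z :=
    ContinuousAt.comp' (differentiableAt_Gamma _ hpole').continuousAt (by fun_prop)
  have hD : ContinuousAt (fun w : ℂ ↦ (w - 1) * (Real.pi : ℂ) ^ (-w / 2) *
      Complex.Gamma (w / 2 + 1)) z := by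
    refine ContinuousAt.mul (ContinuousAt.mul (by fun_prop) ?_) hG
    exact ContinuousAt.const_cpow (by fun_prop) (.inl hpi)
  have h0 := (hz.tendsto_zero hm).mul (hD.tendsto.mono_left (nhdsWithin_le_nhds (s := {z}ᶜ)))
  rw [zero_mul] at h0
  refine tendsto_nhds_unique (hc.tendsto.mono_left nhdsWithin_le_nhds) (h0.congr' ?_)
  have hne' (c : ℂ) : ∀ᶠ w in 𝓝[≠] z, w ≠ c := by
    rcases eq_or_ne z c with rfl | h
    · exact self_mem_nhdsWithin
    · exact (eventually_ne_nhds h).filter_mono nhdsWithin_le_nhds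
  filter_upwards [hne' 0, hne' 1,
    (hG.eventually_ne (Complex.Gamma_ne_zero hpole')).filter_mono nhdsWithin_le_nhds]
    with w h0 h1 h2
  rw [etaFun_eq sν h0, div_mul_cancel₀]
  exact mul_ne_zero (mul_ne_zero (sub_ne_zero.2 h1) (by simp [hpi])) h2

lemma riemannZeta_zeroOfOrder_of_hfun_ne_zero {sν : ℕ → ℂ} {z : ℂ} {m : ℕ}
    (hz : ZeroOfOrder (etaFun sν) z m) (hre : z.re < 0) (ha : AnalyticAt ℂ (hfun sν) z)
    (hne : hfun sν z ≠ 0) : ZeroOfOrder riemannZeta z m := by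
  have hz0 : z ≠ 0 := fun h ↦ by simp [h] at hre
  have hz1 : z ≠ 1 := fun h ↦ by
    rw [h, one_re] at hre
    linarith
  have hΛ : AnalyticAt ℂ completedRiemannZeta z := by
    refine DifferentiableOn.analyticAt (s := {0}ᶜ ∩ {1}ᶜ) (fun w hw ↦
      (differentiableAt_completedZeta hw.1 hw.2).differentiableWithinAt) ?_
    exact (isOpen_compl_singleton.inter isOpen_compl_singleton).mem_nhds ⟨hz0, hz1⟩
  have hΛz : completedRiemannZeta z ≠ 0 := by
    intro h
    have h1 : 1 ≤ (1 - z).re := by simp; exact hre.le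
    have h2 : 1 - z ≠ 0 := fun h ↦ by
      rw [h] at h1
      norm_num at h1
    apply riemannZeta_ne_zero_of_one_le_re h1
    rw [riemannZeta_def_of_ne_zero h2, completedRiemannZeta_one_sub, h, zero_div]
  refine hz.mul_analytic (F := fun w ↦ completedRiemannZeta w * (w / 2 * (w - 1)) / hfun sν w)
    ((hΛ.mul (by fun_prop)).div ha hne) ?_ ?_
  · exact div_ne_zero (mul_ne_zero hΛz (mul_ne_zero (div_ne_zero hz0 two_ne_zero)
      (sub_ne_zero.2 hz1))) hne
  · refine Eventually.filter_mono nhdsWithin_le_nhds ?_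
    filter_upwards [eventually_ne_nhds hz0, eventually_ne_nhds hz1,
      ha.continuousAt.eventually_ne hne] with w h0 h1 h2
    have h1' := sub_ne_zero.2 h1
    rw [riemannZeta_def_of_ne_zero h0, etaFun, mul_assoc (w / 2 * (w - 1)), ← Gammaℝ_def]
    field_simp

lemma ZeroOfOrder.etaFun_of_hfun {sν : ℕ → ℂ} {z : ℂ} {k : ℕ} (hre : 0 < z.re) (hz1 : z ≠ 1)
    (h : ZeroOfOrder (hfun sν) z k) : ZeroOfOrder (etaFun sν) z k := by
  have hz0 : z ≠ 0 := fun h ↦ by simp [h] at hre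
  have hz1' := sub_ne_zero.2 hz1
  refine h.mul_analytic (F := fun w ↦ (w / 2 * (w - 1))⁻¹ * (Gammaℝ w)⁻¹) ?_ ?_ ?_
  · refine AnalyticAt.mul (AnalyticAt.inv (by fun_prop) ?_) (differentiable_Gammaℝ_inv.analyticAt z)
    simp [hz0, hz1']
  · simp [hz0, hz1', Gammaℝ_ne_zero_of_re_pos hre]
  · refine .of_forall fun w ↦ ?_
    rw [etaFun, mul_assoc (w / 2 * (w - 1)), ← Gammaℝ_def, div_eq_mul_inv, mul_inv]

lemma etaFun_zero_cases {sν : ℕ → ℂ} (henum : CriticalZeroEnumFor riemannZeta sν) {z : ℂ} {m : ℕ}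
    (hm : 1 ≤ m) (hz : ZeroOfOrder (etaFun sν) z m) :
    ZeroOfOrder riemannZeta z m ∧ ((∃ n : ℕ, z = -2 * (n + 1)) ∨ z.re = 1 / 2) := by
  have hdich : AnalyticAt ℂ (hfun sν) z ∧ (hfun sν z ≠ 0 ∨
      z.re = 1 / 2 ∧ ∃ k, ZeroOfOrder (hfun sν) z k ∧ ZeroOfOrder riemannZeta z k) := by
    by_cases hs : Summable fun ν ↦ (‖sν ν‖ ^ 2)⁻¹
    · exact hfun_dichotomy_of_summable henum hs z
    · exact (hfun_analyticAt_ne_zero_of_not_summable henum hs hz).imp_right .inl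
  obtain ⟨ha, hne | ⟨hre, k, hk, hζ⟩⟩ := hdich
  · obtain ⟨n, hn⟩ := eq_neg_two_mul_of_hfun_ne_zero hm hz ha.continuousAt hne
    refine ⟨riemannZeta_zeroOfOrder_of_hfun_ne_zero hz ?_ ha hne, .inl ⟨n, hn⟩⟩
    rw [hn]
    simp
    positivity
  · have hpos : 0 < z.re := by rw [hre]; norm_num
    have hz1 : z ≠ 1 := fun h ↦ by
      rw [h, one_re] at hre
      norm_num at hre
    rw [hz.unique (hk.etaFun_of_hfun hpos hz1)]
    exact ⟨hζ, .inr hre⟩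

/-- Every zero of `η` is a zero of `ζ` with at least the same multiplicity; the only zeros
of `η` with `Re s < 0` are the poles `s = -2, -4, …` of `Γ(s/2)` (the trivial zeros of `ζ`);
and every zero of `η` with `Re s ≥ 0` lies on the line `Re s = 1/2`. -/
theorem etaFun_zeros (sν : ℕ → ℂ)
    (henum : CriticalZeroEnumFor riemannZeta sν) :
    (∀ (z : ℂ) (m : ℕ), 1 ≤ m → ZeroOfOrder (etaFun sν) z m →
      ∃ k : ℕ, m ≤ k ∧ ZeroOfOrder riemannZeta z k) ∧
    (∀ (z : ℂ) (m : ℕ), 1 ≤ m → ZeroOfOrder (etaFun sν) z m → z.re < 0 →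
      ∃ n : ℕ, z = -2 * (n + 1)) ∧
    (∀ (z : ℂ) (m : ℕ), 1 ≤ m → ZeroOfOrder (etaFun sν) z m → 0 ≤ z.re →
      z.re = 1 / 2) := by
  refine ⟨fun z m hm hz ↦ ⟨m, le_rfl, (etaFun_zero_cases henum hm hz).1⟩,
    fun z m hm hz hre ↦ ?_, fun z m hm hz hre ↦ ?_⟩
  · refine (etaFun_zero_cases henum hm hz).2.resolve_right fun h ↦ ?_
    linarith
  · refine (etaFun_zero_cases henum hm hz).2.resolve_left fun ⟨n, hn⟩ ↦ ?_
    rw [hn] at hre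
    simp at hre
    have : (0 : ℝ) ≤ n := n.cast_nonneg
    linarith
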